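/- For all n ≥ 4, the number of permutations π ∈ S_n such that π, θ(π), and θ²(π) all avoid the pattern 213 is t_n^2(213) = C(n+1, 2) = n(n+1)/2. -/

import Mathlib

/-- The one-line word of the image of `π` under the fundamental bijection:
write `π` in standard cycle form (every cycle written with its largest element
first, cycles listed in increasing order of their largest elements) and erase
the parentheses.  The cycle maxima are exactly the `x` with `π^[k] x ≤ x` for
all `k`, and the cycle of `x` is `x, π x, π² x, …` up to the period of `x`. -/
noncomputable def fundWord {n : ℕ} (π : Equiv.Perm (Fin n)) : List (Fin n) :=
  ((List.finRange n).filter fun x => (List.range n).all fun k => decide ((⇑π)^[k] x ≤ x)).flatMap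
    fun x => (List.range (Function.minimalPeriod (⇑π) x)).map fun k => (⇑π)^[k] x

/-- The permutation whose one-line notation is the word `w`
(junk value if `w` is not the one-line notation of a permutation). -/
noncomputable def permOfWord {n : ℕ} (w : List (Fin n)) : Equiv.Perm (Fin n) :=
  Function.invFun (fun σ : Equiv.Perm (Fin n) => (List.finRange n).map ⇑σ) w

/-- The fundamental bijection `θ`. -/
noncomputable def theta {n : ℕ} (π : Equiv.Perm (Fin n)) : Equiv.Perm (Fin n) :=
  permOfWord (fundWord π)

/-- `π` contains the pattern `σ`. -/
def Contains {k n : ℕ} (σ : Equiv.Perm (Fin k)) (π : Equiv.Perm (Fin n)) : Prop :=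
  ∃ f : Fin k → Fin n, StrictMono f ∧ ∀ a b : Fin k, π (f a) < π (f b) ↔ σ a < σ b

/-- `π` avoids the pattern `σ`. -/
def Avoids {k n : ℕ} (π : Equiv.Perm (Fin n)) (σ : Equiv.Perm (Fin k)) : Prop :=
  ¬ Contains σ π

noncomputable def p123 : Equiv.Perm (Fin 3) := Equiv.ofBijective ![0, 1, 2] (by decide)
noncomputable def p132 : Equiv.Perm (Fin 3) := Equiv.ofBijective ![0, 2, 1] (by decide)
noncomputable def p213 : Equiv.Perm (Fin 3) := Equiv.ofBijective ![1, 0, 2] (by decide)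
noncomputable def p231 : Equiv.Perm (Fin 3) := Equiv.ofBijective ![1, 2, 0] (by decide)
noncomputable def p312 : Equiv.Perm (Fin 3) := Equiv.ofBijective ![2, 0, 1] (by decide)
noncomputable def p321 : Equiv.Perm (Fin 3) := Equiv.ofBijective ![2, 1, 0] (by decide)

/-- The direct sum `π ⊕ τ` of two permutations. -/
def directSum {n m : ℕ} (π : Equiv.Perm (Fin n)) (τ : Equiv.Perm (Fin m)) :
    Equiv.Perm (Fin (n + m)) :=
  finSumFinEquiv.permCongr (Equiv.sumCongr π τ)

/-- A permutation is irreducible if it is not a direct sum of two nonempty permutations. -/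
def IrreduciblePerm {n : ℕ} (π : Equiv.Perm (Fin n)) : Prop :=
  ¬ ∃ (a b : ℕ) (_ : 0 < a) (_ : 0 < b) (h : a + b = n)
      (σ : Equiv.Perm (Fin a)) (τ : Equiv.Perm (Fin b)),
      π = (finCongr h).permCongr (directSum σ τ)

/-- A permutation is cyclic if its cycle decomposition is a single cycle of full length,
i.e. it acts transitively. -/
def IsCyclicPerm {n : ℕ} (π : Equiv.Perm (Fin n)) : Prop :=
  ∀ x y : Fin n, ∃ k : ℕ, (⇑π)^[k] x = y

/-- `StdStep π q` says how `π` acts on the letters of the word `q 0, q 1, …`, when this word is the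
standard cycle form of `π`: `π` sends a letter to the next one, unless the next one is a
left-to-right maximum or does not exist; then `π` sends it to the latest left-to-right maximum. -/
def StdStep {n : ℕ} (π q : Equiv.Perm (Fin n)) : Prop :=
  ∀ i, ∃ l ≤ i, (∀ l' ≤ i, q l' ≤ q l) ∧
    ((∃ j : Fin n, j.val = i.val + 1 ∧ π (q i) = q j ∧ q j < q l) ∨
      (π (q i) = q l ∧ ∀ j : Fin n, j.val = i.val + 1 → q l < q j))

lemma StdStep.unique {n : ℕ} {π π' q : Equiv.Perm (Fin n)} (h : StdStep π q)
    (h' : StdStep π' q) : π = π' := by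
  ext x
  obtain ⟨i, rfl⟩ := q.surjective x
  obtain ⟨l, hl, hmax, hc⟩ := h i
  obtain ⟨l', hl', hmax', hc'⟩ := h' i
  have hll : q l = q l' := le_antisymm (hmax' l hl) (hmax l' hl')
  rcases hc with ⟨j, hj, hj1, hj2⟩ | ⟨hj1, hj2⟩ <;>
    rcases hc' with ⟨k, hk, hk1, hk2⟩ | ⟨hk1, hk2⟩
  · have : j = k := Fin.ext (by omega)
    rw [hj1, hk1, this]
  · exact absurd (hk2 j hj) (by rw [← hll]; exact hj2.asymm)
  · exact absurd (hj2 k hk) (by rw [hll]; exact hk2.asymm)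
  · rw [hj1, hk1, hll]

lemma List.flatMap_eq_append_cons {α β : Type*} (f : α → List β) (a : β) :
    ∀ (xs : List α) (u v : List β), xs.flatMap f = u ++ a :: v →
      ∃ xs₁ x xs₂ u' v', xs = xs₁ ++ x :: xs₂ ∧ f x = u' ++ a :: v' ∧
        u = xs₁.flatMap f ++ u' ∧ v = v' ++ xs₂.flatMap f := by
  intro xs
  induction xs with
  | nil => intro u v h; simp at h
  | cons y ys ih =>
    intro u v h
    rw [List.flatMap_cons, List.append_eq_append_iff] at h
    rcases h with ⟨w, rfl, hw⟩ | ⟨w, hw, hv⟩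
    · obtain ⟨xs₁, x, xs₂, u', v', rfl, h1, rfl, rfl⟩ := ih w v hw
      exact ⟨y :: xs₁, x, xs₂, u', v', rfl, h1, by simp, rfl⟩
    · cases w with
      | nil =>
        obtain ⟨xs₁, x, xs₂, u', v', rfl, h1, h2, rfl⟩ := ih [] v (by simpa using hv.symm)
        refine ⟨y :: xs₁, x, xs₂, u', v', rfl, h1, ?_, rfl⟩
        rw [List.flatMap_cons, List.append_assoc, ← h2, hw]
        simp
      | cons b w =>
        obtain ⟨rfl, rfl⟩ := List.cons.inj hv
        exact ⟨[], y, ys, u, w, rfl, hw, rfl, rfl⟩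

section FundWord

variable {n : ℕ} (π : Equiv.Perm (Fin n))

lemma minimalPeriod_perm_pos (x : Fin n) : 0 < Function.minimalPeriod (⇑π) x :=
  Function.minimalPeriod_pos_of_mem_periodicPts
    (Function.Injective.mem_periodicPts π.injective x)

lemma minimalPeriod_perm_le (x : Fin n) : Function.minimalPeriod (⇑π) x ≤ n := by
  have h := Finset.card_le_univ
    ((Finset.range (Function.minimalPeriod (⇑π) x)).image fun k => (⇑π)^[k] x)
  rw [Finset.card_image_of_injOn, Finset.card_range, Fintype.card_fin] at h
  · exact h
  · intro a ha b hb hab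
    exact Function.iterate_injOn_Iio_minimalPeriod (by simpa using ha) (by simpa using hb) hab

lemma exists_iterate_lt_minimalPeriod (x : Fin n) (k : ℕ) :
    ∃ l < Function.minimalPeriod (⇑π) x, (⇑π)^[l] x = (⇑π)^[k] x :=
  ⟨_, Nat.mod_lt _ (minimalPeriod_perm_pos π x), Function.iterate_mod_minimalPeriod_eq⟩

/-- The increasing list of the cycle maxima. -/
def cycleMaxima : List (Fin n) :=
  (List.finRange n).filter fun x => (List.range n).all fun k => decide ((⇑π)^[k] x ≤ x)

/-- The cycle of `x`, read from `x` on. -/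
noncomputable def cycleWord (x : Fin n) : List (Fin n) :=
  (List.range (Function.minimalPeriod (⇑π) x)).map fun k => (⇑π)^[k] x

lemma fundWord_eq : fundWord π = (cycleMaxima π).flatMap (cycleWord π) := rfl

lemma mem_cycleMaxima {x : Fin n} : x ∈ cycleMaxima π ↔ ∀ k, (⇑π)^[k] x ≤ x := by
  simp only [cycleMaxima, List.mem_filter, List.mem_finRange, true_and, List.all_eq_true,
    List.mem_range, decide_eq_true_eq]
  refine ⟨fun h k => ?_, fun h k _ => h k⟩
  obtain ⟨l, hl, hlk⟩ := exists_iterate_lt_minimalPeriod π x k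
  rw [← hlk]
  exact h l (hl.trans_le (minimalPeriod_perm_le π x))

lemma mem_cycleWord {x y : Fin n} : y ∈ cycleWord π x ↔ ∃ k, (⇑π)^[k] x = y := by
  simp only [cycleWord, List.mem_map, List.mem_range]
  refine ⟨fun ⟨k, _, h⟩ => ⟨k, h⟩, fun ⟨k, h⟩ => ?_⟩
  obtain ⟨l, hl, hlk⟩ := exists_iterate_lt_minimalPeriod π x k
  exact ⟨l, hl, hlk.trans h⟩

lemma pairwise_cycleMaxima : (cycleMaxima π).Pairwise (· < ·) :=
  (List.pairwise_lt_finRange n).filter _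

lemma exists_iterate_symm (x : Fin n) (k : ℕ) : ∃ l, (⇑π)^[l] ((⇑π)^[k] x) = x := by
  have hp := minimalPeriod_perm_pos π x
  refine ⟨Function.minimalPeriod (⇑π) x * k - k, ?_⟩
  rw [← Function.iterate_add_apply, Nat.sub_add_cancel (Nat.le_mul_of_pos_left k hp)]
  exact (Function.isPeriodicPt_minimalPeriod (⇑π) x).mul_const k

lemma nodup_fundWord : (fundWord π).Nodup := by
  rw [fundWord_eq, List.nodup_flatMap]
  constructor
  · intro x _
    refine List.Nodup.map_on ?_ List.nodup_range
    intro a ha b hb hab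
    exact Function.iterate_injOn_Iio_minimalPeriod (by simpa using ha) (by simpa using hb) hab
  · refine ((pairwise_cycleMaxima π).imp_of_mem ?_)
    intro x y hx hy hxy z hzx hzy
    rw [mem_cycleWord] at hzx hzy
    obtain ⟨k, rfl⟩ := hzx
    obtain ⟨l, hl⟩ := hzy
    obtain ⟨l', hl'⟩ := exists_iterate_symm π y l
    rw [hl, ← Function.iterate_add_apply] at hl'
    have := (mem_cycleMaxima π).1 hx (l' + k)
    rw [hl'] at this
    exact absurd hxy (not_lt.2 this)

lemma mem_fundWord (y : Fin n) : y ∈ fundWord π := by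
  rw [fundWord_eq, List.mem_flatMap]
  obtain ⟨k, -, hk⟩ := Finset.exists_max_image (Finset.range n) (fun k => (⇑π)^[k] y)
    ⟨0, Finset.mem_range.2 y.pos⟩
  have hk' : ∀ l, (⇑π)^[l] y ≤ (⇑π)^[k] y := by
    intro l
    obtain ⟨l', hl, hl'⟩ := exists_iterate_lt_minimalPeriod π y l
    rw [← hl']
    exact hk l' (Finset.mem_range.2 (hl.trans_le (minimalPeriod_perm_le π y)))
  refine ⟨(⇑π)^[k] y, (mem_cycleMaxima π).2 fun l => ?_,
    (mem_cycleWord π).2 (exists_iterate_symm π y k)⟩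
  rw [← Function.iterate_add_apply]
  exact hk' _

lemma map_theta : (List.finRange n).map (theta π) = fundWord π := by
  have hlen : (fundWord π).length = n := by
    rw [← List.toFinset_card_of_nodup (nodup_fundWord π),
      Finset.eq_univ_iff_forall.2 fun y => List.mem_toFinset.2 (mem_fundWord π y),
      Finset.card_univ, Fintype.card_fin]
  refine Function.invFun_eq (f := fun σ : Equiv.Perm (Fin n) => (List.finRange n).map ⇑σ)
    ⟨(finCongr hlen.symm).trans
      (List.Nodup.getEquivOfForallMemList _ (nodup_fundWord π) (mem_fundWord π)), ?_⟩
  apply List.ext_getElem <;> simp [hlen]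

lemma fundWord_split {u v : List (Fin n)} {a : Fin n} (h : fundWord π = u ++ a :: v) :
    ∃ x ∈ u ++ [a], (∀ c ∈ u ++ [a], c ≤ x) ∧
      ((∃ v', v = π a :: v' ∧ π a < x) ∨ (π a = x ∧ ∀ b v', v = b :: v' → x < b)) := by
  rw [fundWord_eq] at h
  obtain ⟨xs₁, x, xs₂, u', v', hxs, hfx, rfl, rfl⟩ := List.flatMap_eq_append_cons _ _ _ _ _ h
  have hmax : ∀ y ∈ cycleMaxima π, ∀ k, (⇑π)^[k] y ≤ y := fun y => (mem_cycleMaxima π).1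
  have hpw := pairwise_cycleMaxima π
  rw [hxs] at hmax hpw
  rw [List.pairwise_append, List.pairwise_cons] at hpw
  obtain ⟨-, ⟨hpw2, -⟩, hpw1⟩ := hpw
  have hp := minimalPeriod_perm_pos π x
  have hlen : u'.length + (v'.length + 1) = Function.minimalPeriod (⇑π) x := by
    have := congrArg List.length hfx
    simpa [cycleWord] using this.symm
  have hget : ∀ k, k < Function.minimalPeriod (⇑π) x →
      (u' ++ a :: v')[k]? = some ((⇑π)^[k] x) := by
    intro k hk
    rw [← hfx]
    simp [cycleWord, hk]
  have ha : (⇑π)^[u'.length] x = a := by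
    have := hget u'.length (by omega)
    simpa using this.symm
  have hsub : ∀ c ∈ u' ++ [a], c ≤ x := by
    intro c hc
    have : c ∈ cycleWord π x := by
      rw [hfx]; simp only [List.mem_append, List.mem_cons] at hc ⊢; grind
    obtain ⟨k, rfl⟩ := (mem_cycleWord π).1 this
    exact hmax x (by simp) k
  refine ⟨x, ?_, ?_, ?_⟩
  · have h0 := hget 0 hp
    rcases u' with _ | ⟨c, u'⟩
    · simp at h0; simp [h0]
    · simp at h0; simp [h0]
  · intro c hc
    rw [List.append_assoc, List.mem_append] at hc
    rcases hc with hc | hc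
    · obtain ⟨y, hy, hcy⟩ := List.mem_flatMap.1 hc
      obtain ⟨k, rfl⟩ := (mem_cycleWord π).1 hcy
      exact (hmax y (by simp [hy]) k).trans (hpw1 y hy x (by simp)).le
    · exact hsub c hc
  · rcases v' with _ | ⟨b, v'⟩
    · right
      have hax : π a = x := by
        have hs : (⇑π)^[u'.length + 1] x = π a := by rw [Function.iterate_succ_apply', ha]
        simp only [List.length_nil] at hlen
        rw [← hs, show u'.length + 1 = _ from hlen]
        exact Function.isPeriodicPt_minimalPeriod _ _
      refine ⟨hax, fun b w hb => ?_⟩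
      rcases xs₂ with _ | ⟨y, xs₂⟩
      · simp at hb
      · have hy := hpw2 y (by simp)
        have hpy := minimalPeriod_perm_pos π y
        have : (cycleWord π y)[0]? = some y := by simp [cycleWord, hpy]
        rcases hcy : cycleWord π y with _ | ⟨z, zs⟩
        · simp [hcy] at this
        · simp [hcy] at this hb
          rw [← hb.1, this]; exact hy
    · left
      have hb := hget (u'.length + 1) (by simp at hlen; omega)
      rw [Function.iterate_succ_apply', ha] at hb
      simp at hb
      refine ⟨v' ++ xs₂.flatMap (cycleWord π), by simp [hb], ?_⟩
      refine lt_of_le_of_ne ?_ ?_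
      · have := hmax x (by simp) (u'.length + 1)
        rwa [Function.iterate_succ_apply', ha] at this
      · intro hx
        have h1 : (⇑π)^[u'.length + 1] x = (⇑π)^[0] x := by
          rw [Function.iterate_succ_apply', ha, hx]; rfl
        have := Function.iterate_injOn_Iio_minimalPeriod (f := ⇑π) (x := x)
          (by simp at hlen ⊢; omega) (by simpa using hp) h1
        omega

lemma stdStep_theta : StdStep π (theta π) := by
  intro i
  set q := theta π with hq
  have hw : fundWord π = ((List.finRange n).take i).map q ++
      q i :: ((List.finRange n).drop (i + 1)).map q := by
    rw [← map_theta, ← hq]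
    conv_lhs => rw [← List.take_append_drop i (List.finRange n),
      List.drop_eq_getElem_cons (by simp)]
    simp
  have hmem : ∀ c, c ∈ ((List.finRange n).take i).map q ++ [q i] ↔ ∃ l ≤ i, q l = c := by
    intro c
    simp only [List.mem_append, List.mem_map, List.mem_singleton, List.mem_take_iff_getElem]
    constructor
    · rintro (⟨l, ⟨k, hk, rfl⟩, rfl⟩ | rfl)
      · refine ⟨_, ?_, rfl⟩
        simp [Fin.le_def] at hk ⊢
        omega
      · exact ⟨i, le_rfl, rfl⟩
    · rintro ⟨l, hl, rfl⟩
      rcases hl.lt_or_eq with h | rfl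
      · left
        exact ⟨l, ⟨l, by simpa using h, by simp⟩, rfl⟩
      · right; rfl
  have hnext : ∀ j : Fin n, j.val = i.val + 1 →
      ∃ w, ((List.finRange n).drop (i + 1)).map q = q j :: w := by
    intro j hj
    refine ⟨((List.finRange n).drop (i + 2)).map q, ?_⟩
    rw [List.drop_eq_getElem_cons (by simp; omega)]
    simp [← hj]
    omega
  obtain ⟨x, hx, hmax, hc⟩ := fundWord_split π hw
  obtain ⟨l, hl, rfl⟩ := (hmem x).1 hx
  refine ⟨l, hl, fun l' hl' => hmax _ ((hmem _).2 ⟨l', hl', rfl⟩), ?_⟩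
  rcases hc with ⟨v', hv, hlt⟩ | ⟨h1, h2⟩
  · left
    have hi : i.val + 1 < n := by
      have := congrArg List.length hv
      simp at this
      omega
    obtain ⟨w, hw'⟩ := hnext ⟨i + 1, hi⟩ rfl
    rw [hw'] at hv
    have := (List.cons.inj hv).1
    exact ⟨⟨i + 1, hi⟩, rfl, this.symm, this ▸ hlt⟩
  · right
    refine ⟨h1, fun j hj => ?_⟩
    obtain ⟨w, hw'⟩ := hnext j hj
    exact h2 _ _ hw'

lemma theta_injective : Function.Injective (theta : Equiv.Perm (Fin n) → Equiv.Perm (Fin n)) :=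
  fun π π' h => (stdStep_theta π).unique (h ▸ stdStep_theta π')

lemma theta_bijective : Function.Bijective (theta : Equiv.Perm (Fin n) → Equiv.Perm (Fin n)) :=
  Finite.injective_iff_bijective.1 theta_injective

end FundWord

lemma StdStep.theta_eq {n : ℕ} {π q : Equiv.Perm (Fin n)} (h : StdStep π q) : theta π = q := by
  obtain ⟨π', rfl⟩ := theta_bijective.surjective q
  rw [h.unique (stdStep_theta π')]

/-- `f` and `g` restrict to mutually inverse permutations of `{0, …, N}`. -/
structure InvOn (N : ℕ) (f g : ℕ → ℕ) : Prop where
  le : ∀ i ≤ N, f i ≤ N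
  le' : ∀ i ≤ N, g i ≤ N
  left : ∀ i ≤ N, g (f i) = i
  right : ∀ i ≤ N, f (g i) = i

/-- The word `f 0, …, f N` avoids `213`. -/
def NoTwoOneThree (N : ℕ) (f : ℕ → ℕ) : Prop :=
  ∀ i j k, i < j → j < k → k ≤ N → f j < f i → f k ≤ f i

/-- `p` fixes the letters of the word `q 0, …, q N` before the largest letter `q s = N`, and
the rest of the word is a cycle of `p`. -/
structure SingleCycle (N : ℕ) (p q : ℕ → ℕ) (s : ℕ) : Prop where
  le : s ≤ N
  top : q s = N
  fix : ∀ i < s, p (q i) = q i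
  step : ∀ i, s ≤ i → i < N → p (q i) = q (i + 1)
  last : p (q N) = N

section Classification

variable {N : ℕ} {p p' q q' r r' : ℕ → ℕ} {s t : ℕ}

lemma InvOn.inj (h : InvOn N p p') {i j : ℕ} (hi : i ≤ N) (hj : j ≤ N) (hij : p i = p j) :
    i = j := by
  rw [← h.left i hi, ← h.left j hj, hij]

lemma NoTwoOneThree.lt_of_lt_top (h : NoTwoOneThree N q) (hq : InvOn N q q') (ht : t ≤ N)
    (htop : q t = N) {i j : ℕ} (hij : i < j) (hj : j ≤ t) : q i < q j := by
  have h1 := hq.le i (by omega)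
  have h2 : q i ≠ q j := fun h => by have := hq.inj (by omega) (by omega) h; omega
  rcases hj.lt_or_eq with hj | rfl
  · by_contra h3
    have h4 := h i j t hij hj ht (by omega)
    have := hq.inj (i := i) (j := t) (by omega) (by omega) (by omega)
    omega
  · omega

lemma NoTwoOneThree.lt_of_zero (h : NoTwoOneThree N q) (hq : InvOn N q q') {i c l : ℕ}
    (hic : i < c) (hcl : c < l) (hl : l ≤ N) (hc : q c = 0) : q l < q i := by
  have h1 : q i ≠ 0 := fun h => by
    have := hq.inj (i := i) (j := c) (by omega) (by omega) (by omega); omega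
  have h2 := h i c l hic hcl hl (by omega)
  have h3 : q l ≠ q i := fun h => by have := hq.inj (by omega) (by omega) h; omega
  omega

lemma NoTwoOneThree.top_lt_zero (h : NoTwoOneThree N q) (hq : InvOn N q q') (ht : t ≤ N)
    (htop : q t = N) (h0 : q 0 ≠ 0) {c : ℕ} (hc : q c = 0) : t < c := by
  by_contra hct
  have hc0 : c ≠ 0 := fun h => h0 (h ▸ hc)
  have := h.lt_of_lt_top hq ht htop (i := 0) (j := c) (by omega) (by omega)
  omega

lemma SingleCycle.apply_zero_ne (hpq : SingleCycle N p q t) (h : NoTwoOneThree N q)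
    (hq : InvOn N q q') (hN : 1 ≤ N) (h0 : q 0 ≠ 0) : p 0 ≠ 0 := by
  have hc := hq.right 0 (by omega)
  have hcN := hq.le' 0 (by omega)
  have htc := h.top_lt_zero hq hpq.le hpq.top h0 hc
  rcases hcN.lt_or_eq with hlt | heq
  · have := hpq.step _ htc.le hlt
    rw [hc] at this
    intro h0'
    have := hq.inj (i := q' 0 + 1) (j := q' 0) (by omega) (by omega) (by omega)
    omega
  · have := hpq.last
    rw [← heq, hc] at this
    omega

lemma SingleCycle.fixed_of_notMem (hqr : SingleCycle N q r s) (hr : InvOn N r r') {S : Set ℕ}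
    (hS : N ∈ S) (hcl : ∀ x ∈ S, q x ∈ S) {x : ℕ} (hx : x ≤ N) (hxS : x ∉ S) : q x = x := by
  have hmem : ∀ i, s ≤ i → i ≤ N → r i ∈ S := by
    intro i hi
    induction i, hi using Nat.le_induction with
    | base => intro _; rw [hqr.top]; exact hS
    | succ i hi ih =>
      intro hiN
      rw [← hqr.step i hi (by omega)]
      exact hcl _ (ih (by omega))
  have hx' := hr.right x hx
  rcases lt_or_ge (r' x) s with h | h
  · have := hqr.fix _ h
    rwa [hx'] at this
  · exact absurd (hx' ▸ hmem _ h (hr.le' x hx)) hxS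

lemma NoTwoOneThree.succ_le_of_le_top (h : NoTwoOneThree N p) (hp : InvOn N p p') (ht : t ≤ N)
    (htop : p t = N) (h0 : p 0 ≠ 0) : ∀ i ≤ t, i + 1 ≤ p i := by
  intro i
  induction i with
  | zero => intro _; omega
  | succ i ih =>
    intro hi
    have := ih (by omega)
    have := h.lt_of_lt_top hp ht htop (i := i) (j := i + 1) (by omega) hi
    omega

/-- The shape of `q` when its word starts with the largest letter. -/
lemma shape_of_head_top (hp : InvOn N p p') (hq : InvOn N q q') (hr : InvOn N r r')
    (ap : NoTwoOneThree N p) (aq : NoTwoOneThree N q) (hpq : SingleCycle N p q 0)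
    (hqr : SingleCycle N q r s) (hN : 2 ≤ N) :
    q N < N ∧ (∀ i, 1 ≤ i → i ≤ q N → q i = i - 1) ∧ ∀ i, q N < i → i < N → q i = i := by
  have hq0 : q 0 = N := hpq.top
  have hp0 := hpq.apply_zero_ne aq hq (by omega) (by omega)
  have hqN : q N < N := by
    have := hq.le N le_rfl
    have : q N ≠ q 0 := fun h => by have := hq.inj le_rfl (by omega) h; omega
    omega
  have key : ∀ i, 1 ≤ i → i ≤ q N → q i = i - 1 := by
    rcases Nat.eq_zero_or_pos (q N) with hκ | hκ
    · intro i _ _; omega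
    have hc := hq.right 0 (by omega)
    set c := q' 0 with hcdef
    have hcN : c < N := by
      have := hq.le' 0 (by omega)
      have : c ≠ N := fun h => by rw [h] at hc; omega
      omega
    have hc0 : c ≠ 0 := fun h => by rw [h] at hc; omega
    have hc1 : c = 1 := by
      by_contra hc1
      have hd := hpq.step c (by omega) hcN
      have he := hpq.step 0 le_rfl (by omega)
      rw [hc] at hd
      rw [hq0] at he
      have hb := aq.lt_of_zero hq (i := 1) (by omega) (l := c + 1) (by omega) hcN hc
      have hm := hp.right 0 (by omega)
      have hmN := hp.le' 0 (by omega)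
      have hm0 : p' 0 ≠ 0 := fun h => hp0 (by rw [h] at hm; exact hm)
      have hmN' : p' 0 ≠ N := fun h => by
        rw [h] at hm
        have := hq.inj (i := 1) (j := c) (by omega) (by omega) (by simp at he; omega)
        omega
      have := ap.lt_of_zero hp (i := 0) (l := N) (by omega) (by omega) le_rfl hm
      simp at he
      omega
    rw [hc1] at hc
    intro i
    induction i using Nat.strong_induction_on with
    | _ i ih =>
    intro hi1 hiκ
    rcases Nat.lt_or_ge i 2 with hi | hi
    · rw [show i = 1 by omega, hc]
    by_contra hne
    have hqi : i - 1 < q i := by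
      by_contra hlt
      have h1 := ih (q i + 1) (by omega) (by omega) (by omega)
      have := hq.inj (i := q i + 1) (j := i) (by omega) (by omega) (by omega)
      omega
    have hj := hq.right (i - 1) (by omega)
    have hjN := hq.le' (i - 1) (by omega)
    set j := q' (i - 1)
    have hij : i < j := by
      by_contra hle
      rcases Nat.eq_zero_or_pos j with h0 | h0
      · rw [h0] at hj; omega
      · rcases Nat.lt_or_ge j i with h1 | h1
        · have := ih j h1 h0 (by omega); omega
        · rw [show j = i by omega] at hj; omega
    have hjN' : j ≠ N := fun h => by rw [h] at hj; omega
    have h1 := hpq.step j (by omega) (by omega)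
    have h2 := hpq.step (i - 1) (by omega) (by omega)
    rw [hj] at h1
    rw [ih (i - 1) (by omega) (by omega) (by omega), show i - 1 + 1 = i by omega] at h2
    have h3 := ap.lt_of_lt_top hp (hq.le N le_rfl) hpq.last (i := i - 1 - 1) (j := i - 1)
      (by omega) (by omega)
    have := aq i j (j + 1) hij (by omega) (by omega) (by omega)
    omega
  refine ⟨hqN, key, fun i hi hiN => ?_⟩
  refine hqr.fixed_of_notMem hr (S := {x | x ≤ q N ∨ x = N}) (Or.inr rfl) ?_ hiN.le
    (by simp; omega)
  rintro x (hx | rfl)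
  · rcases Nat.eq_zero_or_pos x with rfl | h0
    · exact Or.inr hq0
    · left
      have := key x h0 hx
      omega
  · exact Or.inl le_rfl

lemma last_eq_zero (hp : InvOn N p p') (hq : InvOn N q q') (hr : InvOn N r r')
    (ap : NoTwoOneThree N p) (aq : NoTwoOneThree N q) (ar : NoTwoOneThree N r)
    (hpq : SingleCycle N p q t) (hqr : SingleCycle N q r s) (hN : 2 ≤ N) (h0 : r 0 ≠ 0)
    (ht : t ≠ 0) : q N = 0 := by
  have htN := hpq.le
  have hqtop := hpq.top
  have hq0 := hqr.apply_zero_ne ar hr (by omega) h0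
  have hp0 := hpq.apply_zero_ne aq hq (by omega) hq0
  have hc := hq.right 0 (by omega)
  set c := q' 0
  have htc : t < c := aq.top_lt_zero hq hpq.le hpq.top hq0 hc
  have hcN : c ≤ N := hq.le' 0 (by omega)
  by_contra hqN
  have hcN : c ≠ N := fun h => hqN (h ▸ hc)
  have hd := hpq.step c (by omega) (by omega)
  rw [hc] at hd
  have hbd := aq.lt_of_zero hq (i := 0) (l := c + 1) (by omega) (by omega) (by omega) hc
  have hb := hpq.fix 0 (by omega)
  have hκ : q N < q 0 := by
    by_contra hle
    have := ap.succ_le_of_le_top hp (hq.le N le_rfl) hpq.last hp0 (q 0) (by omega)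
    omega
  have hc0 := hr.right 0 (by omega)
  set c0 := r' 0
  have hsc : s < c0 := ar.top_lt_zero hr hqr.le hqr.top h0 hc0
  have hc0N : c0 ≤ N := hr.le' 0 (by omega)
  have hrN : r N = t := hq.inj (hr.le N le_rfl) htN (by rw [hqr.last, hqtop])
  have hc0N : c0 ≠ N := fun h => by rw [h] at hc0; omega
  have h1 := hqr.step c0 hsc.le (by omega)
  have h2 := hqr.step s le_rfl (by omega)
  rw [hc0] at h1
  rw [hqr.top] at h2
  rcases Nat.lt_or_ge (s + 1) c0 with h3 | h3
  · have := ar.lt_of_zero hr h3 (l := c0 + 1) (by omega) (by omega) hc0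
    omega
  · rw [show s + 1 = c0 by omega, hc0] at h2
    omega

/-- The shape of `q` when its word does not start with the largest letter. -/
lemma shape_of_last_zero (hp : InvOn N p p') (hq : InvOn N q q') (hr : InvOn N r r')
    (ap : NoTwoOneThree N p) (aq : NoTwoOneThree N q) (ar : NoTwoOneThree N r)
    (hpq : SingleCycle N p q t) (hqr : SingleCycle N q r s) (hN : 2 ≤ N) (h0 : r 0 ≠ 0)
    (ht : t ≠ 0) :
    q N = 0 ∧ ((∀ i < N, q i = i + 1) ∨ N = 3 ∧ q 0 = 2 ∧ q 1 = 3 ∧ q 2 = 1) := by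
  have hqN := last_eq_zero hp hq hr ap aq ar hpq hqr hN h0 ht
  refine ⟨hqN, ?_⟩
  have htN := hpq.le
  have hqtop := hpq.top
  have hq0 := hqr.apply_zero_ne ar hr (by omega) h0
  have hp0 := hpq.last
  rw [hqN] at hp0
  have hrN : r N = t := hq.inj (hr.le N le_rfl) htN (by rw [hqr.last, hqtop])
  have hrtop := hqr.top
  have hqi : ∀ i j, i ≤ N → j ≤ N → q i = q j → i = j := fun i j => hq.inj
  have hri : ∀ i j, i ≤ N → j ≤ N → r i = r j → i = j := fun i j => hr.inj
  have hpi : ∀ i j, i ≤ N → j ≤ N → p i = p j → i = j := fun i j => hp.inj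
  have htN' : t ≠ N := by rintro rfl; omega
  have hsN : s ≠ N := by
    rintro rfl
    omega
  have hs := hqr.le
  have hr1 := hqr.step s le_rfl (by omega)
  rw [hrtop, hqN] at hr1
  have hsN1 : s + 1 ≠ N := fun h => by rw [h] at hr1; omega
  have hr2 := hqr.step (s + 1) (by omega) (by omega)
  rw [← hr1] at hr2
  have hb := hpq.fix 0 (by omega)
  have hpN := hpq.step t le_rfl (by omega)
  rw [hqtop] at hpN
  have hbN := hq.le 0 (by omega)
  have hbN' : q 0 ≠ N := fun h => ht (hqi t 0 htN (by omega) (by omega))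
  have hs0 : s = 0 := by
    by_contra hs0
    have hx := hr.right (N - 1) (by omega)
    have hxN := hr.le' (N - 1) (by omega)
    set x := r' (N - 1)
    have hxs : x < s := by
      by_contra hle
      have h1 : x ≠ s := fun h => by rw [h] at hx; omega
      have h2 : x ≠ s + 1 := fun h => by rw [h] at hx; omega
      have h3 := ar.lt_of_zero hr (i := 0) (c := s + 1) (l := x) (by omega) (by omega) hxN hr1.symm
      have h4 := hr.le 0 (by omega)
      exact hs0 (hri s 0 hs (by omega) (by omega))
    have hfix := hqr.fix x hxs
    rw [hx] at hfix
    have htN1 : t ≠ N - 1 := fun h => by rw [h] at hqtop; omega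
    have hm := hpq.step (N - 1) (by omega) (by omega)
    rw [hfix, show N - 1 + 1 = N by omega, hqN] at hm
    have hy := hp.right 1 (by omega)
    have hyN := hp.le' 1 (by omega)
    set y := p' 1
    have hyN' : y = N := by
      by_contra hyN'
      have h1 : y ≠ N - 1 := fun h => by rw [h] at hy; omega
      have h2 := ap.lt_of_zero hp (i := y) (l := N) (by omega) (by omega) le_rfl hm
      have := hpi (N - 1) N (by omega) le_rfl (by omega)
      omega
    rw [hyN'] at hy
    have ht1 : t + 1 ≠ N - 1 := fun h => by
      rw [h] at hpN
      omega
    have h3 : q 0 ≠ 1 := fun h => by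
      have := hqi 0 (t + 1) (by omega) (by omega) (by omega); omega
    have h4 : q 0 ≠ N - 1 := fun h => by
      have := hqi 0 (N - 1) (by omega) (by omega) (by omega); omega
    have := aq 0 (t + 1) (N - 1) (by omega) (by omega) (by omega) (by omega)
    omega
  subst hs0
  rcases Nat.lt_or_ge t (N - 1) with htN1 | htN1
  swap
  · left
    have hlow := aq.succ_le_of_le_top hq htN hqtop hq0
    have hup : ∀ k ≤ t, q (t - k) + k ≤ N := by
      intro k
      induction k with
      | zero => intro _; simp [hqtop]
      | succ k ih =>
        intro hk
        have h1 := ih (by omega)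
        have h2 := aq.lt_of_lt_top hq htN hqtop (i := t - (k + 1)) (j := t - k)
          (by omega) (by omega)
        omega
    intro i hi
    have h1 := hlow i (by omega)
    have h2 := hup (t - i) (by omega)
    rw [show t - (t - i) = i by omega] at h2
    omega
  right
  have he0 : q (t + 1) ≠ 0 := fun h => by
    have := hqi (t + 1) N (by omega) le_rfl (by omega); omega
  have hm := hpq.step (N - 1) (by omega) (by omega)
  rw [show N - 1 + 1 = N by omega, hqN] at hm
  have hmN := hq.le (N - 1) (by omega)
  have hmN' : q (N - 1) ≠ N := fun h => by rw [h] at hm; omega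
  have hm0 : q (N - 1) ≠ 0 := fun h => by rw [h] at hm; omega
  have hbm : q (N - 1) < q 0 := by
    by_contra hle
    have h1 : q 0 ≠ q (N - 1) := fun h => by have := hqi _ _ (by omega) (by omega) h; omega
    have h2 := ap.lt_of_zero hp (i := q 0) (l := N) (by omega) (by omega) le_rfl hm
    have h3 : t + 1 ≠ N - 1 := fun h => by rw [h] at hpN; omega
    have := aq 0 (t + 1) (N - 1) (by omega) (by omega) (by omega) (by omega)
    omega
  simp only [zero_add, Nat.reduceAdd] at hr1 hr2 hsN1
  have ht1 : t = 1 := by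
    by_contra ht1
    have hz := hr.right 1 (by omega)
    have hzN := hr.le' 1 (by omega)
    set z := r' 1
    have h1 : z ≠ 0 := fun h => by rw [h] at hz; omega
    have h2 : z ≠ 1 := fun h => by rw [h] at hz; omega
    have h3 : z ≠ 2 := fun h => by rw [h] at hz; omega
    have h4 : z ≠ N := fun h => by rw [h] at hz; omega
    have h5 := hqr.step z (by omega) (by omega)
    rw [hz] at h5
    have h6 := aq.lt_of_lt_top hq htN hqtop (i := 0) (j := 1) (by omega) (by omega)
    have := ar 2 z (z + 1) (by omega) (by omega) (by omega) (by omega)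
    omega
  subst ht1
  simp only [Nat.reduceAdd] at hpN he0
  rcases Nat.lt_or_ge (q 0) (N - 1) with hbN1 | hbN1
  · exfalso
    have hbe : q 0 < q 2 := by
      by_contra hle
      have h0 : q 0 ≠ q 2 := fun h => by have := hqi _ _ (by omega) (by omega) h; omega
      have hy := hq.right (N - 1) (by omega)
      have hyN := hq.le' (N - 1) (by omega)
      set y := q' (N - 1)
      have h1 : y ≠ 0 := fun h => by rw [h] at hy; omega
      have h2 : y ≠ 1 := fun h => by rw [h] at hy; omega
      have h3 : y ≠ 2 := fun h => by rw [h] at hy; omega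
      have := aq 0 2 y (by omega) (by omega) (by omega) (by omega)
      omega
    have hb2 : q 0 = 2 := by
      by_contra hb2
      have hz := hr.right 2 (by omega)
      have hzN := hr.le' 2 (by omega)
      set z := r' 2
      have h1 : z ≠ 0 := fun h => by rw [h] at hz; omega
      have h2 : z ≠ 1 := fun h => by rw [h] at hz; omega
      have h3 : z ≠ 2 := fun h => by rw [h] at hz; omega
      have h4 : z ≠ N := fun h => by rw [h] at hz; omega
      have h5 := hqr.step z (by omega) (by omega)
      rw [hz] at h5
      have := ar 2 z (z + 1) (by omega) (by omega) (by omega) (by omega)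
      omega
    rw [hb2] at hb
    rw [show q (N - 1) = 1 by omega] at hm
    have hx := hp.right 1 (by omega)
    have hxN := hp.le' 1 (by omega)
    set x := p' 1
    have h1 : x ≠ 0 := fun h => by rw [h] at hx; omega
    have h2 : x ≠ 1 := fun h => by rw [h] at hx; omega
    have h3 : x ≠ 2 := fun h => by rw [h] at hx; omega
    have h4 : x ≠ N := fun h => by rw [h] at hx; omega
    have := ap 2 x N (by omega) (by omega) (by omega) (by omega)
    omega
  · have hb' : q 0 = N - 1 := by omega
    rw [hb'] at hb
    have hm1 : q (N - 1) = 1 := by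
      by_contra hm1
      have h1 := ap.lt_of_zero hp (i := 1) (l := N - 1) (by omega) (by omega) (by omega) hm
      have h2 := hp.le 1 (by omega)
      have := hpi 0 1 (by omega) (by omega) (by omega)
      omega
    have h3 := hqr.step 2 (by omega) (by omega)
    rw [← hr2, hb', hm1] at h3
    have h3 := hri 3 N (by omega) le_rfl (by rw [hrN, ← h3])
    subst h3
    exact ⟨rfl, hb', hqtop, hm1⟩

end Classification

/-- A permutation of `Fin n` as a function on `ℕ`. -/
def natFun {n : ℕ} (σ : Equiv.Perm (Fin n)) (i : ℕ) : ℕ :=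
  if h : i < n then (σ ⟨i, h⟩ : ℕ) else 0

lemma natFun_of_lt {n : ℕ} (σ : Equiv.Perm (Fin n)) {i : ℕ} (h : i < n) :
    natFun σ i = σ ⟨i, h⟩ := dif_pos h

@[simp] lemma natFun_val {n : ℕ} (σ : Equiv.Perm (Fin n)) (i : Fin n) : natFun σ i = σ i :=
  natFun_of_lt σ i.2

lemma natFun_ext {n : ℕ} {σ τ : Equiv.Perm (Fin n)} (h : ∀ i < n, natFun σ i = natFun τ i) :
    σ = τ := by
  ext i
  simpa using h i i.2

section Bridge

variable {N : ℕ}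

lemma invOn_natFun (σ : Equiv.Perm (Fin (N + 1))) : InvOn N (natFun σ) (natFun σ.symm) where
  le i hi := by rw [natFun_of_lt σ (by omega)]; omega
  le' i hi := by rw [natFun_of_lt _ (by omega)]; omega
  left i hi := by rw [natFun_of_lt σ (by omega)]; simp
  right i hi := by rw [natFun_of_lt σ.symm (by omega)]; simp

lemma avoids_p213_iff (σ : Equiv.Perm (Fin (N + 1))) :
    Avoids σ p213 ↔ NoTwoOneThree N (natFun σ) := by
  have h0 : p213 0 = 1 := rfl
  have h1 : p213 1 = 0 := rfl
  have h2 : p213 2 = 2 := rfl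
  constructor
  · intro h i j k hij hjk hk h21
    by_contra h13
    rw [natFun_of_lt σ (by omega), natFun_of_lt σ (by omega)] at h21 h13
    have hji : σ ⟨j, by omega⟩ < σ ⟨i, by omega⟩ := h21
    have hik : σ ⟨i, by omega⟩ < σ ⟨k, by omega⟩ := not_le.1 h13
    have hjk' := hji.trans hik
    refine h ⟨![⟨i, by omega⟩, ⟨j, by omega⟩, ⟨k, by omega⟩], ?_, ?_⟩
    · rw [Fin.strictMono_iff_lt_succ]
      intro a
      fin_cases a <;> simpa
    · intro a b
      fin_cases a <;> fin_cases b <;> simp [h0, h1, h2, hji, hik, hjk', hji.le, hik.le, hjk'.le]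
  · rintro h ⟨f, hf, hp⟩
    have h01 : f 0 < f 1 := hf (by decide)
    have h12 : f 1 < f 2 := hf (by decide)
    have h21 : σ (f 1) < σ (f 0) := (hp 1 0).2 (by rw [h0, h1]; decide)
    have h13 : σ (f 0) < σ (f 2) := (hp 0 2).2 (by rw [h0, h2]; decide)
    have := h (f 0) (f 1) (f 2) h01 h12 (by omega) (by simpa using h21)
    simp only [natFun_val] at this
    omega

lemma exists_singleCycle {π : Equiv.Perm (Fin (N + 1))} (h : Avoids (theta π) p213) :
    ∃ s, SingleCycle N (natFun π) (natFun (theta π)) s := by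
  have hstep := stdStep_theta π
  rw [avoids_p213_iff] at h
  set q := theta π
  have hq := invOn_natFun q
  have hs := hq.le' N le_rfl
  have htop := hq.right N le_rfl
  set s := natFun q.symm N
  have key : ∀ i ≤ N, ∃ l ≤ i, (∀ l' ≤ i, natFun q l' ≤ natFun q l) ∧
      ((i + 1 ≤ N ∧ natFun π (natFun q i) = natFun q (i + 1) ∧ natFun q (i + 1) < natFun q l) ∨
        (natFun π (natFun q i) = natFun q l ∧ (i + 1 ≤ N → natFun q l < natFun q (i + 1)))) := by
    intro i hi
    obtain ⟨l, hl, hmax, hc⟩ := hstep ⟨i, by omega⟩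
    refine ⟨l, hl, fun l' hl' => ?_, ?_⟩
    · rw [natFun_of_lt q (by omega), natFun_val]
      exact hmax ⟨l', by omega⟩ hl'
    · rw [natFun_of_lt q (by omega : i < N + 1), natFun_val, natFun_val]
      rcases hc with ⟨j, hj, h1, h2⟩ | ⟨h1, h2⟩
      · simp only at hj
        left
        rw [← hj, natFun_val, h1]
        exact ⟨by omega, rfl, h2⟩
      · right
        refine ⟨by rw [h1], fun hi' => ?_⟩
        rw [natFun_of_lt q (by omega)]
        exact h2 ⟨i + 1, by omega⟩ rfl
  refine ⟨s, hs, htop, fun i hi => ?_, fun i hi hiN => ?_, ?_⟩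
  · obtain ⟨l, hl, hmax, hc⟩ := key i (by omega)
    have h1 := hmax i le_rfl
    have h2 := h.lt_of_lt_top hq hs htop (Nat.lt_succ_self i) hi
    have h3 : l = i := by
      by_contra hli
      have := h.lt_of_lt_top hq hs htop (i := l) (j := i) (by omega) hi.le
      omega
    subst h3
    simp only [Nat.succ_eq_add_one] at h2
    omega
  · obtain ⟨l, hl, hmax, hc⟩ := key i (by omega)
    have h1 := hmax s hi
    have h2 := hq.le (i + 1) (by omega)
    omega
  · obtain ⟨l, hl, hmax, hc⟩ := key N le_rfl
    have h1 := hmax s hs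
    have h2 := hq.le l (by omega)
    omega

lemma theta_eq_of_singleCycle {π q : Equiv.Perm (Fin (N + 1))} {s : ℕ} (hq : Avoids q p213)
    (h : SingleCycle N (natFun π) (natFun q) s) : theta π = q := by
  obtain ⟨π', rfl⟩ := theta_bijective.surjective q
  obtain ⟨s', h'⟩ := exists_singleCycle hq
  have hinv := invOn_natFun (theta π')
  have hss := hinv.inj h.le h'.le (h.top.trans h'.top.symm)
  subst hss
  congr 1
  refine natFun_ext fun x hx => ?_
  have hi := hinv.le' x (by omega)
  rw [← hinv.right x (by omega)]
  set i := natFun (theta π').symm x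
  rcases lt_or_ge i s with hs | hs
  · rw [h.fix i hs, h'.fix i hs]
  · rcases hi.lt_or_eq with hi | hi
    · rw [h.step i hs hi, h'.step i hs hi]
    · rw [hi, h.last, h'.last]

lemma NoTwoOneThree.congr {f g : ℕ → ℕ} (h : NoTwoOneThree N f) (hfg : ∀ i ≤ N, g i = f i) :
    NoTwoOneThree N g := by
  intro i j k hij hjk hk
  rw [hfg i (by omega), hfg j (by omega), hfg k hk]
  exact h i j k hij hjk hk

lemma SingleCycle.congr {p q p₁ q₁ : ℕ → ℕ} {s : ℕ} (h : SingleCycle N p q s)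
    (hp : ∀ i ≤ N, p₁ i = p i) (hq : ∀ i ≤ N, q₁ i = q i) (hle : ∀ i ≤ N, q i ≤ N) :
    SingleCycle N p₁ q₁ s where
  le := h.le
  top := (hq s h.le).trans h.top
  fix i hi := by
    have := h.le
    rw [hq i (by omega), hp _ (hle i (by omega)), h.fix i hi]
  step i hi hiN := by
    rw [hq i (by omega), hp _ (hle i (by omega)), h.step i hi hiN, hq (i + 1) (by omega)]
  last := by rw [hq N le_rfl, hp _ (hle N le_rfl), h.last]

lemma exists_perm_natFun {f : ℕ → ℕ} (hle : ∀ i ≤ N, f i ≤ N)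
    (hinj : ∀ i ≤ N, ∀ j ≤ N, f i = f j → i = j) :
    ∃ σ : Equiv.Perm (Fin (N + 1)), ∀ i ≤ N, natFun σ i = f i := by
  let g : Fin (N + 1) → Fin (N + 1) := fun i => ⟨f i, by have := hle i (by omega); omega⟩
  have hg : Function.Injective g := fun i j hij =>
    Fin.ext (hinj i (by omega) j (by omega) (congrArg Fin.val hij))
  exact ⟨Equiv.ofBijective g (Finite.injective_iff_bijective.1 hg), fun i hi => by
    rw [natFun_of_lt _ (by omega)]; rfl⟩

end Bridge

/-- The permutations `π` such that `π`, `θ(π)` and `θ²(π)` avoid `213`. -/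
def iterAvoiders (n : ℕ) : Set (Equiv.Perm (Fin n)) :=
  {π | ∀ i ≤ 2, Avoids (theta^[i] π) p213}

lemma mem_iterAvoiders {n : ℕ} {π : Equiv.Perm (Fin n)} :
    π ∈ iterAvoiders n ↔
      Avoids π p213 ∧ Avoids (theta π) p213 ∧ Avoids (theta (theta π)) p213 := by
  constructor
  · intro h
    exact ⟨h 0 (by omega), h 1 (by omega), h 2 le_rfl⟩
  · rintro ⟨h0, h1, h2⟩ i hi
    interval_cases i
    exacts [h0, h1, h2]

lemma mem_iterAvoiders_of_fun {N s t : ℕ} {p q r : ℕ → ℕ}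
    (lp : ∀ i ≤ N, p i ≤ N) (lq : ∀ i ≤ N, q i ≤ N) (lr : ∀ i ≤ N, r i ≤ N)
    (ip : ∀ i ≤ N, ∀ j ≤ N, p i = p j → i = j) (iq : ∀ i ≤ N, ∀ j ≤ N, q i = q j → i = j)
    (ir : ∀ i ≤ N, ∀ j ≤ N, r i = r j → i = j)
    (ap : NoTwoOneThree N p) (aq : NoTwoOneThree N q) (ar : NoTwoOneThree N r)
    (hpq : SingleCycle N p q t) (hqr : SingleCycle N q r s) :
    ∃ π ∈ iterAvoiders (N + 1), (∀ i ≤ N, natFun π i = p i) ∧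
      ∀ i ≤ N, natFun (theta π) i = q i := by
  obtain ⟨π, hπ⟩ := exists_perm_natFun lp ip
  obtain ⟨σ, hσ⟩ := exists_perm_natFun lq iq
  obtain ⟨ρ, hρ⟩ := exists_perm_natFun lr ir
  have aσ := (avoids_p213_iff σ).2 (aq.congr hσ)
  have aρ := (avoids_p213_iff ρ).2 (ar.congr hρ)
  have hπσ := theta_eq_of_singleCycle aσ (hpq.congr hπ hσ lq)
  have hσρ := theta_eq_of_singleCycle aρ (hqr.congr hσ hρ lr)
  refine ⟨π, mem_iterAvoiders.2 ⟨(avoids_p213_iff π).2 (ap.congr hπ), ?_, ?_⟩, hπ, ?_⟩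
  · rwa [hπσ]
  · rwa [hπσ, hσρ]
  · rwa [hπσ]

/-- The words of the members `π` of `iterAvoiders (N + 1)` with `π 0 ≠ 0`, for `N ≠ 3`. -/
def familyFun (N k i : ℕ) : ℕ :=
  if k = 0 then (if i = 0 then N else if i = N then 0 else i)
  else if i = N then (if k = 1 then 1 else 0)
  else if i + 1 = k then N
  else if i + 2 = k then (if k = N then i + 1 else k)
  else if i + 1 = N then k - 1
  else i + 1

/-- The words of the images under `θ` of the permutations with words `familyFun`. -/
def thetaFamilyFun (N k i : ℕ) : ℕ :=
  if k = 0 then (if i = N then 0 else i + 1)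
  else if i = 0 then N
  else if i = N then k - 1
  else if i < k then i - 1
  else i

/-- The words of the images under `θ²` of the permutations with words `familyFun`. -/
def thetaThetaFamilyFun (N k i : ℕ) : ℕ :=
  if k = 0 then (if i = 0 then N else i - 1)
  else if i + k ≤ N then k + i else N - i

lemma noTwoOneThree_familyFun {N k : ℕ} (hk : k ≤ N) : NoTwoOneThree N (familyFun N k) := by
  intro i j l hij hjl hl
  rcases Nat.eq_zero_or_pos k with rfl | hk0
  · simp only [familyFun, if_true]
    split_ifs <;> omega
  · simp only [familyFun, if_neg hk0.ne']
    grind (splits := 20)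

lemma exists_family {N k : ℕ} (hN : 2 ≤ N) (hk : k ≤ N) :
    ∃ π ∈ iterAvoiders (N + 1), (∀ i ≤ N, natFun π i = familyFun N k i) ∧
      ∀ i ≤ N, natFun (theta π) i = thetaFamilyFun N k i := by
  apply mem_iterAvoiders_of_fun (r := thetaThetaFamilyFun N k)
    (s := if k = 0 then 0 else N - k) (t := if k = 0 then N - 1 else 0)
  · intro i hi; unfold familyFun; grind
  · intro i hi; unfold thetaFamilyFun; grind
  · intro i hi; unfold thetaThetaFamilyFun; grind
  · intro i hi j hj; unfold familyFun; grind
  · intro i hi j hj; unfold thetaFamilyFun; grind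
  · intro i hi j hj; unfold thetaThetaFamilyFun; grind
  · exact noTwoOneThree_familyFun hk
  · intro i j l hij hjl hl; unfold thetaFamilyFun; split_ifs <;> omega
  · intro i j l hij hjl hl; unfold thetaThetaFamilyFun; split_ifs <;> omega
  · constructor
    · grind
    · unfold thetaFamilyFun; grind
    · intro i hi; unfold familyFun thetaFamilyFun; grind
    · intro i hi; unfold familyFun thetaFamilyFun; grind
    · unfold familyFun thetaFamilyFun; grind
  · constructor
    · grind
    · unfold thetaThetaFamilyFun; grind
    · intro i hi; unfold thetaThetaFamilyFun thetaFamilyFun; grind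
    · intro i hi; unfold thetaThetaFamilyFun thetaFamilyFun; grind
    · unfold thetaThetaFamilyFun thetaFamilyFun; grind

section Counting

variable {N : ℕ}

lemma theta_zero_ne {π : Equiv.Perm (Fin (N + 1))} (hN : 1 ≤ N)
    (h : Avoids (theta π) p213) (h0 : natFun π 0 ≠ 0) : natFun (theta π) 0 ≠ 0 := by
  obtain ⟨s, hs⟩ := exists_singleCycle h
  intro hq
  rcases Nat.eq_zero_or_pos s with rfl | hs0
  · have := hs.top; omega
  · have := hs.fix 0 hs0
    rw [hq] at this
    exact h0 this

lemma theta_eq_family_or {π : Equiv.Perm (Fin (N + 1))} (hN : 2 ≤ N)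
    (h : π ∈ iterAvoiders (N + 1)) (h0 : natFun π 0 ≠ 0) :
    (∃ k ≤ N, ∀ i ≤ N, natFun (theta π) i = thetaFamilyFun N k i) ∨
      N = 3 ∧ natFun (theta π) 0 = 2 ∧ natFun (theta π) 1 = 3 ∧ natFun (theta π) 2 = 1 ∧
        natFun (theta π) 3 = 0 := by
  obtain ⟨hπ, hq, hr⟩ := mem_iterAvoiders.1 h
  obtain ⟨t, ht⟩ := exists_singleCycle hq
  obtain ⟨s, hs⟩ := exists_singleCycle hr
  have hr0 := theta_zero_ne (by omega) hr (theta_zero_ne (by omega) hq h0)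
  rw [avoids_p213_iff] at hπ hq hr
  have ip := invOn_natFun π
  have iq := invOn_natFun (theta π)
  have ir := invOn_natFun (theta (theta π))
  rcases Nat.eq_zero_or_pos t with rfl | htpos
  · obtain ⟨h1, h2, h3⟩ := shape_of_head_top ip iq ir hπ hq ht hs hN
    have htop := ht.top
    refine Or.inl ⟨natFun (theta π) N + 1, h1, fun i hi => ?_⟩
    unfold thetaFamilyFun
    rw [if_neg (Nat.succ_ne_zero _)]
    split_ifs with c2 c3 c4
    · rw [c2, htop]
    · rw [c3, Nat.add_sub_cancel]
    · exact h2 i (by omega) (by omega)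
    · exact h3 i (by omega) (by omega)
  · obtain ⟨h1, h2 | ⟨rfl, h2, h3, h4⟩⟩ :=
      shape_of_last_zero ip iq ir hπ hq hr ht hs hN hr0 htpos.ne'
    · refine Or.inl ⟨0, by omega, fun i hi => ?_⟩
      unfold thetaFamilyFun
      rw [if_pos rfl]
      split_ifs with c
      · rw [c, h1]
      · exact h2 i (by omega)
    · exact Or.inr ⟨rfl, h2, h3, h4, h1⟩

lemma exists_family_enumeration (hN : 2 ≤ N) :
    ∃ G : Fin (N + 1) → Equiv.Perm (Fin (N + 1)), Function.Injective G ∧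
      (∀ k, G k ∈ iterAvoiders (N + 1) ∧ natFun (G k) 0 ≠ 0 ∧
        ∀ i ≤ N, natFun (theta (G k)) i = thetaFamilyFun N k i) ∧
      ∀ π ∈ iterAvoiders (N + 1), natFun π 0 ≠ 0 → π ∈ Set.range G ∨
        N = 3 ∧ natFun (theta π) 0 = 2 ∧ natFun (theta π) 1 = 3 ∧ natFun (theta π) 2 = 1 ∧
          natFun (theta π) 3 = 0 := by
  choose G hG hGp hGq using fun k : Fin (N + 1) => exists_family hN (Nat.le_of_lt_succ k.2)
  refine ⟨G, fun k l hkl => ?_, fun k => ⟨hG k, ?_, hGq k⟩, fun π hπ h0 => ?_⟩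
  · have h1 := (hGq k 0 (by omega)).symm.trans (hkl ▸ hGq l 0 (by omega))
    have h2 := (hGq k N le_rfl).symm.trans (hkl ▸ hGq l N le_rfl)
    ext
    unfold thetaFamilyFun at h1 h2
    split_ifs at h1 h2 <;> omega
  · rw [hGp k 0 (by omega)]
    unfold familyFun
    split_ifs <;> omega
  · refine (theta_eq_family_or hN hπ h0).imp_left ?_
    rintro ⟨k, hk, h⟩
    refine ⟨⟨k, by omega⟩, theta_injective (natFun_ext fun i hi => ?_)⟩
    rw [hGq _ i (by omega), h i (by omega)]

lemma ncard_ne_zero (hN : 2 ≤ N) (hN3 : N ≠ 3) :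
    {π ∈ iterAvoiders (N + 1) | natFun π 0 ≠ 0}.ncard = N + 1 := by
  obtain ⟨G, hinj, hG, hall⟩ := exists_family_enumeration hN
  have : {π ∈ iterAvoiders (N + 1) | natFun π 0 ≠ 0} = Set.range G := by
    ext π
    constructor
    · rintro ⟨h, h0⟩
      exact (hall π h h0).resolve_right fun h => hN3 h.1
    · rintro ⟨k, rfl⟩
      exact ⟨(hG k).1, (hG k).2.1⟩
  rw [this, ← Nat.card_coe_set_eq, Nat.card_range_of_injective hinj, Nat.card_fin]

lemma exists_sporadic :
    ∃ π ∈ iterAvoiders 4, natFun π 0 ≠ 0 ∧ natFun (theta π) 0 = 2 ∧ natFun (theta π) 1 = 3 ∧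
      natFun (theta π) 2 = 1 ∧ natFun (theta π) 3 = 0 := by
  let p : ℕ → ℕ := fun i => if i = 0 then 3 else if i = 1 then 0 else if i = 2 then 2 else 1
  let q : ℕ → ℕ := fun i => if i = 0 then 2 else if i = 1 then 3 else if i = 2 then 1 else 0
  have ap : NoTwoOneThree 3 p := by
    intro i j k hij hjk hk; simp only [p]; split_ifs <;> omega
  have aq : NoTwoOneThree 3 q := by
    intro i j k hij hjk hk; simp only [q]; split_ifs <;> omega
  have lp : ∀ i ≤ 3, p i ≤ 3 := by decide
  have lq : ∀ i ≤ 3, q i ≤ 3 := by decide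
  have ip : ∀ i ≤ 3, ∀ j ≤ 3, p i = p j → i = j := by decide
  have iq : ∀ i ≤ 3, ∀ j ≤ 3, q i = q j → i = j := by decide
  obtain ⟨π, h, hp, hq⟩ := mem_iterAvoiders_of_fun (N := 3) (s := 0) (t := 1) lp lq lp ip iq ip
    ap aq ap
    ⟨by decide, rfl, by decide, fun i h1 h2 => by interval_cases i <;> rfl, rfl⟩
    ⟨by decide, rfl, by decide, fun i h1 h2 => by interval_cases i <;> rfl, rfl⟩
  refine ⟨π, h, ?_, hq 0 (by decide), hq 1 (by decide), hq 2 (by decide), hq 3 le_rfl⟩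
  rw [hp 0 (by decide)]
  decide

lemma ncard_ne_zero_four : {π ∈ iterAvoiders 4 | natFun π 0 ≠ 0}.ncard = 5 := by
  obtain ⟨G, hinj, hG, hall⟩ := exists_family_enumeration (N := 3) (by omega)
  obtain ⟨σ, hσ, hσ0, h0, h1, h2, h3⟩ := exists_sporadic
  have hset : {π ∈ iterAvoiders 4 | natFun π 0 ≠ 0} = insert σ (Set.range G) := by
    ext π
    constructor
    · rintro ⟨h, hπ0⟩
      rcases hall π h hπ0 with h | ⟨-, h0', h1', h2', h3'⟩
      · exact Or.inr h
      · refine Or.inl (theta_injective (natFun_ext fun i hi => ?_))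
        interval_cases i <;> simp [*]
    · rintro (rfl | ⟨k, rfl⟩)
      · exact ⟨hσ, hσ0⟩
      · exact ⟨(hG k).1, (hG k).2.1⟩
  have hnot : σ ∉ Set.range G := by
    rintro ⟨k, rfl⟩
    rw [(hG k).2.2 0 (by omega)] at h0
    rw [(hG k).2.2 1 (by omega)] at h1
    unfold thetaFamilyFun at h0 h1
    split_ifs at h0 h1 <;> omega
  rw [hset, Set.ncard_insert_of_notMem hnot, ← Nat.card_coe_set_eq,
    Nat.card_range_of_injective hinj, Nat.card_fin]

end Counting

/-- The direct sum `1 ⊕ σ`. -/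
def oneSum {n : ℕ} (σ : Equiv.Perm (Fin n)) : Equiv.Perm (Fin (n + 1)) :=
  Equiv.Perm.decomposeFin.symm (0, σ)

section OneSum

variable {n : ℕ}

@[simp] lemma oneSum_zero (σ : Equiv.Perm (Fin n)) : oneSum σ 0 = 0 :=
  Equiv.Perm.decomposeFin_symm_apply_zero 0 σ

@[simp] lemma oneSum_succ (σ : Equiv.Perm (Fin n)) (i : Fin n) :
    oneSum σ i.succ = (σ i).succ := by
  simp [oneSum]

lemma oneSum_injective : Function.Injective (oneSum : Equiv.Perm (Fin n) → _) := fun _ _ h =>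
  congrArg Prod.snd (Equiv.Perm.decomposeFin.symm.injective h)

lemma exists_oneSum {π : Equiv.Perm (Fin (n + 1))} (h : π 0 = 0) : ∃ σ, oneSum σ = π := by
  obtain ⟨⟨a, σ⟩, rfl⟩ := Equiv.Perm.decomposeFin.symm.surjective π
  rw [Equiv.Perm.decomposeFin_symm_apply_zero] at h
  exact ⟨σ, by rw [h]; rfl⟩

lemma StdStep.oneSum {π q : Equiv.Perm (Fin n)} (h : StdStep π q) :
    StdStep (oneSum π) (oneSum q) := by
  intro i
  cases i using Fin.cases with
  | zero =>
    refine ⟨0, le_rfl, fun l' hl' => ?_, Or.inr ⟨by simp, fun j hj => ?_⟩⟩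
    · rw [Fin.le_zero_iff.1 hl']
    · cases j using Fin.cases with
      | zero => simp at hj
      | succ j => simp
  | succ i =>
    obtain ⟨l, hl, hmax, hc⟩ := h i
    refine ⟨l.succ, Fin.succ_le_succ_iff.2 hl, fun l' hl' => ?_, ?_⟩
    · cases l' using Fin.cases with
      | zero => simp
      | succ l' => simpa using hmax l' (Fin.succ_le_succ_iff.1 hl')
    · refine hc.imp ?_ ?_
      · rintro ⟨j, hj, h1, h2⟩
        exact ⟨j.succ, by simp [hj], by simp [h1], by simpa using h2⟩
      · rintro ⟨h1, h2⟩
        refine ⟨by simp [h1], fun j hj => ?_⟩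
        cases j using Fin.cases with
        | zero => simp at hj
        | succ j => simpa using h2 j (by simpa using hj)

lemma theta_oneSum (π : Equiv.Perm (Fin n)) : theta (oneSum π) = oneSum (theta π) :=
  (stdStep_theta π).oneSum.theta_eq

lemma avoids_oneSum {N : ℕ} (σ : Equiv.Perm (Fin (N + 1))) :
    Avoids (oneSum σ) p213 ↔ Avoids σ p213 := by
  have hs : ∀ i ≤ N, natFun (oneSum σ) (i + 1) = natFun σ i + 1 := by
    intro i hi
    rw [natFun_of_lt _ (by omega), natFun_of_lt σ (by omega)]
    exact congrArg Fin.val (oneSum_succ σ ⟨i, by omega⟩)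
  have h0 : natFun (oneSum σ) 0 = 0 := by
    rw [natFun_of_lt _ (by omega)]
    exact congrArg Fin.val (oneSum_zero σ)
  rw [avoids_p213_iff, avoids_p213_iff]
  constructor
  · intro h i j k hij hjk hk h21
    have := h (i + 1) (j + 1) (k + 1) (by omega) (by omega) (by omega)
    rw [hs i (by omega), hs j (by omega), hs k hk] at this
    omega
  · intro h i j k hij hjk hk h21
    obtain ⟨j, rfl⟩ : ∃ j', j = j' + 1 := ⟨j - 1, by omega⟩
    obtain ⟨k, rfl⟩ : ∃ k', k = k' + 1 := ⟨k - 1, by omega⟩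
    rcases i with _ | i
    · omega
    · rw [hs i (by omega), hs j (by omega)] at h21
      rw [hs i (by omega), hs k (by omega)]
      have := h i j k (by omega) (by omega) (by omega) (by omega)
      omega

lemma ncard_iterAvoiders_succ (N : ℕ) :
    (iterAvoiders (N + 2)).ncard = (iterAvoiders (N + 1)).ncard +
      {π ∈ iterAvoiders (N + 2) | natFun π 0 ≠ 0}.ncard := by
  have hmem : ∀ σ : Equiv.Perm (Fin (N + 1)),
      oneSum σ ∈ iterAvoiders (N + 2) ↔ σ ∈ iterAvoiders (N + 1) := by
    intro σ
    simp only [mem_iterAvoiders, theta_oneSum, avoids_oneSum]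
  have hzero : ∀ π : Equiv.Perm (Fin (N + 2)), natFun π 0 = 0 ↔ π 0 = 0 := by
    intro π
    rw [natFun_of_lt π (by omega), Fin.ext_iff]
    rfl
  have hset : iterAvoiders (N + 2) = oneSum '' iterAvoiders (N + 1) ∪
      {π ∈ iterAvoiders (N + 2) | natFun π 0 ≠ 0} := by
    ext π
    constructor
    · intro h
      by_cases h0 : natFun π 0 = 0
      · obtain ⟨σ, rfl⟩ := exists_oneSum ((hzero π).1 h0)
        exact Or.inl ⟨σ, (hmem σ).1 h, rfl⟩
      · exact Or.inr ⟨h, h0⟩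
    · rintro (⟨σ, h, rfl⟩ | h)
      · exact (hmem σ).2 h
      · exact h.1
  conv_lhs => rw [hset]
  rw [Set.ncard_union_eq, Set.ncard_image_of_injective _ oneSum_injective]
  rw [Set.disjoint_left]
  rintro _ ⟨σ, -, rfl⟩ h
  exact h.2 ((hzero _).2 (oneSum_zero σ))

lemma ncard_iterAvoiders_two : (iterAvoiders 2).ncard = 2 := by
  have h : ∀ σ : Equiv.Perm (Fin 2), Avoids σ p213 := by
    intro σ
    rw [avoids_p213_iff]
    intro i j k hij hjk hk
    omega
  have : iterAvoiders 2 = Set.univ :=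
    Set.eq_univ_of_forall fun π => mem_iterAvoiders.2 ⟨h _, h _, h _⟩
  rw [this, Set.ncard_univ, Nat.card_perm, Nat.card_fin]
  rfl

lemma ncard_iterAvoiders_four : (iterAvoiders 4).ncard = 10 := by
  rw [ncard_iterAvoiders_succ 2, ncard_iterAvoiders_succ 1, ncard_iterAvoiders_two,
    ncard_ne_zero_four, ncard_ne_zero (N := 2) le_rfl (by omega)]

end OneSum

/-- for `n ≥ 4`, `t_n^2(213) = C(n+1, 2)`. -/
theorem t2_n_213 (n : ℕ) (hn : 4 ≤ n) :
    Nat.card {π : Equiv.Perm (Fin n) // ∀ i ≤ 2, Avoids (theta^[i] π) p213} =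
      Nat.choose (n + 1) 2 := by
  change Nat.card (iterAvoiders n) = _
  rw [Nat.card_coe_set_eq]
  induction n, hn using Nat.le_induction with
  | base => rw [ncard_iterAvoiders_four]; rfl
  | succ n hn ih =>
    obtain ⟨N, rfl⟩ : ∃ N, n = N + 1 := ⟨n - 1, by omega⟩
    rw [ncard_iterAvoiders_succ, ih, ncard_ne_zero (by omega) (by omega),
      Nat.choose_succ_succ' (N + 1 + 1) 1, Nat.choose_one_right, add_comm]
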